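/- arXiv:2205.08172 — 3 statements merged into one kernel-verified Lean document; each statement's English description precedes it below -/
import Mathlib

section
/- Let d ≥ 2 and let Ω ⊆ ℝ^d be a quasi-conical open set. Then for every λ ≥ 0 and every ε > 0 there exists a smooth, compactly supported, not identically zero function φ : ℝ^d → ℝ with supp φ ⊆ Ω such that ‖Δφ + λφ‖_{L²(ℝ^d)} ≤ ε ‖φ‖_{L²(ℝ^d)}. (This is the Weyl-sequence statement underlying the fact that the spectrum of the Dirichlet Laplacian on any quasi-conical open set contains [0,∞).) -/
open MeasureTheory

/-- The Laplacian `Δφ = Σᵢ ∂²φ/∂xᵢ²` of a function `φ : ℝ^d → ℝ`. -/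
noncomputable def laplacian {d : ℕ} (φ : EuclideanSpace ℝ (Fin d) → ℝ)
    (x : EuclideanSpace ℝ (Fin d)) : ℝ :=
  ∑ i : Fin d, fderiv ℝ (fun y => fderiv ℝ φ y (EuclideanSpace.single i 1)) x
    (EuclideanSpace.single i 1)

/-- An open set is quasi-conical if it contains arbitrarily large balls. -/
def QuasiConical {d : ℕ} (Ω : Set (EuclideanSpace ℝ (Fin d))) : Prop :=
  ∀ r > 0, ∃ y : EuclideanSpace ℝ (Fin d), Metric.ball y r ⊆ Ω

/-- Directional derivatives of a smooth function are smooth. -/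
theorem ContDiff.fderiv_apply_const {E : Type*} [NormedAddCommGroup E] [NormedSpace ℝ E]
    {f : E → ℝ} (hf : ContDiff ℝ (⊤ : ℕ∞) f) (v : E) :
    ContDiff ℝ (⊤ : ℕ∞) (fun x => fderiv ℝ f x v) :=
  (hf.fderiv_right (m := ((⊤ : ℕ∞) : WithTop ℕ∞)) (by simp)).clm_apply contDiff_const

/-- Second directional derivative of a product `f * c`, where `c` and `s` behave under
differentiation along `v` like `cos` and `sin` of a linear phase. -/
theorem fderiv_fderiv_mul_of_trig {E : Type*} [NormedAddCommGroup E] [NormedSpace ℝ E]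
    {f c s : E → ℝ} (hf : ContDiff ℝ (⊤ : ℕ∞) f) (hc : ContDiff ℝ (⊤ : ℕ∞) c)
    (hs : ContDiff ℝ (⊤ : ℕ∞) s) {v : E} {a : ℝ}
    (hcs : ∀ x, fderiv ℝ c x v = -(a * s x)) (hsc : ∀ x, fderiv ℝ s x v = a * c x) (x : E) :
    fderiv ℝ (fun y => fderiv ℝ (fun z => f z * c z) y v) x v =
      c x * fderiv ℝ (fun y => fderiv ℝ f y v) x v - 2 * a * s x * fderiv ℝ f x v
        - a ^ 2 * (f x * c x) := by
  have hfd := hf.differentiable (by simp)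
  have hcd := hc.differentiable (by simp)
  have hsd := hs.differentiable (by simp)
  have hf'd := (hf.fderiv_apply_const v).differentiable (by simp)
  have first : (fun y => fderiv ℝ (fun z => f z * c z) y v)
      = fun y => fderiv ℝ f y v * c y - a * (f y * s y) := by
    funext y
    rw [fderiv_fun_mul (hfd y) (hcd y)]
    simp only [add_apply, smul_apply, smul_eq_mul, hcs]
    ring
  have hfs : DifferentiableAt ℝ (fun y => f y * s y) x := (hfd x).mul (hsd x)
  have hf'c : DifferentiableAt ℝ (fun y => fderiv ℝ f y v * c y) x := (hf'd x).mul (hcd x)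
  rw [first, fderiv_fun_sub hf'c (hfs.const_mul a),
    fderiv_fun_mul (hf'd x) (hcd x), fderiv_const_mul hfs,
    fderiv_fun_mul (hfd x) (hsd x)]
  simp only [add_apply, sub_apply, smul_apply, smul_eq_mul, hcs, hsc]
  ring

theorem laplacian_mul_of_trig {d : ℕ} (i₀ : Fin d) {f c s : EuclideanSpace ℝ (Fin d) → ℝ}
    (hf : ContDiff ℝ (⊤ : ℕ∞) f) (hc : ContDiff ℝ (⊤ : ℕ∞) c) (hs : ContDiff ℝ (⊤ : ℕ∞) s) {k : ℝ}
    (hcs : ∀ x v, fderiv ℝ c x v = -(k * v i₀ * s x))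
    (hsc : ∀ x v, fderiv ℝ s x v = k * v i₀ * c x) (x : EuclideanSpace ℝ (Fin d)) :
    laplacian (fun z => f z * c z) x + k ^ 2 * (f x * c x) =
      c x * laplacian f x - 2 * k * s x * fderiv ℝ f x (EuclideanSpace.single i₀ 1) := by
  unfold laplacian
  simp only [fun i : Fin d => fderiv_fderiv_mul_of_trig hf hc hs (fun y => hcs y _)
    (fun y => hsc y _) (v := EuclideanSpace.single i (1 : ℝ)) x]
  simp only [Finset.sum_sub_distrib, ← Finset.mul_sum, ← Finset.sum_mul]
  have h₁ : ∑ i : Fin d, 2 * (k * (EuclideanSpace.single i (1 : ℝ)) i₀) * s x *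
      fderiv ℝ f x (EuclideanSpace.single i 1) =
      2 * k * s x * fderiv ℝ f x (EuclideanSpace.single i₀ 1) := by
    rw [Finset.sum_eq_single i₀]
    · simp
    · intro i _ hi
      simp [hi.symm]
    · simp
  have h₂ : ∑ i : Fin d, (k * (EuclideanSpace.single i (1 : ℝ)) i₀) ^ 2 = k ^ 2 := by
    rw [Finset.sum_eq_single i₀]
    · simp
    · intro i _ hi
      simp [hi.symm]
    · simp
  rw [h₁, h₂]
  ring

theorem contDiff_laplacian {d : ℕ} {f : EuclideanSpace ℝ (Fin d) → ℝ}
    (hf : ContDiff ℝ (⊤ : ℕ∞) f) : ContDiff ℝ (⊤ : ℕ∞) (laplacian f) :=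
  ContDiff.sum fun _ _ => (hf.fderiv_apply_const _).fderiv_apply_const _

theorem HasCompactSupport.laplacian {d : ℕ} {f : EuclideanSpace ℝ (Fin d) → ℝ}
    (hf : HasCompactSupport f) : HasCompactSupport (laplacian f) := by
  refine hf.of_isClosed_subset (isClosed_tsupport _) (closure_minimal ?_ (isClosed_tsupport _))
  intro x hx
  obtain ⟨i, -, hi⟩ := Finset.exists_ne_zero_of_sum_ne_zero hx
  exact tsupport_fderiv_apply_subset ℝ _
    (subset_tsupport _ hi |> tsupport_fderiv_apply_subset ℝ _)

theorem fderiv_comp_smul_sub {E : Type*} [NormedAddCommGroup E] [NormedSpace ℝ E]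
    {f : E → ℝ} (hf : Differentiable ℝ f) (r : ℝ) (y x v : E) :
    fderiv ℝ (fun z => f (r • (z - y))) x v = r * fderiv ℝ f (r • (x - y)) v := by
  have h : HasFDerivAt (fun z : E => r • (z - y)) (r • ContinuousLinearMap.id ℝ E) x :=
    ((hasFDerivAt_id x).sub_const y).const_smul r
  have := ((hf (r • (x - y))).hasFDerivAt.comp x h).fderiv
  simp only [Function.comp_def] at this
  rw [this]
  simp

theorem laplacian_comp_smul_sub {d : ℕ} {f : EuclideanSpace ℝ (Fin d) → ℝ}
    (hf : ContDiff ℝ (⊤ : ℕ∞) f) (r : ℝ) (y x : EuclideanSpace ℝ (Fin d)) :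
    laplacian (fun z => f (r • (z - y))) x = r ^ 2 * laplacian f (r • (x - y)) := by
  simp only [laplacian, Finset.mul_sum]
  refine Finset.sum_congr rfl fun i _ => ?_
  simp only [fderiv_comp_smul_sub (hf.differentiable (by simp))]
  rw [fderiv_const_mul, smul_apply, smul_eq_mul,
    fderiv_comp_smul_sub (f := fun z => fderiv ℝ f z (EuclideanSpace.single i 1))]
  · ring
  · exact (hf.fderiv_apply_const _).differentiable (by simp)
  · exact ((hf.fderiv_apply_const _).differentiable (by simp)).comp
      ((differentiable_id.sub_const y).const_smul r) x

theorem integrable_sq_of_hasCompactSupport {d : ℕ} {u : EuclideanSpace ℝ (Fin d) → ℝ}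
    (hu : Continuous u) (huc : HasCompactSupport u) : Integrable (fun x => u x ^ 2) := by
  simp only [sq]
  exact (hu.mul hu).integrable_of_hasCompactSupport huc.mul_left

theorem eLpNorm_two_le_of_integral_sq_le {α : Type*} [MeasurableSpace α] {μ : Measure α}
    {f g : α → ℝ} (hf : MemLp f 2 μ) (hg : MemLp g 2 μ) {ε : ℝ} (hε : 0 ≤ ε)
    (h : ∫ x, f x ^ 2 ∂μ ≤ ε ^ 2 * ∫ x, g x ^ 2 ∂μ) :
    eLpNorm f 2 μ ≤ ENNReal.ofReal ε * eLpNorm g 2 μ := by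
  rw [hf.eLpNorm_eq_integral_rpow_norm (by simp) (by simp),
    hg.eLpNorm_eq_integral_rpow_norm (by simp) (by simp), ← ENNReal.ofReal_mul hε]
  apply ENNReal.ofReal_le_ofReal
  simp only [ENNReal.toReal_ofNat, Real.rpow_ofNat, Real.norm_eq_abs, sq_abs]
  rw [← one_div, ← Real.sqrt_eq_rpow, ← Real.sqrt_eq_rpow]
  calc √(∫ x, f x ^ 2 ∂μ) ≤ √(ε ^ 2 * ∫ x, g x ^ 2 ∂μ) := Real.sqrt_le_sqrt h
    _ = ε * √(∫ x, g x ^ 2 ∂μ) := by rw [Real.sqrt_mul (sq_nonneg ε), Real.sqrt_sq hε]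

theorem eLpNorm_laplacian_add_le_of_trig {d : ℕ} (i₀ : Fin d)
    {f c s : EuclideanSpace ℝ (Fin d) → ℝ}
    (hf : ContDiff ℝ (⊤ : ℕ∞) f) (hfc : HasCompactSupport f)
    (hc : ContDiff ℝ (⊤ : ℕ∞) c) (hs : ContDiff ℝ (⊤ : ℕ∞) s) {k : ℝ}
    (hcs : ∀ x v, fderiv ℝ c x v = -(k * v i₀ * s x))
    (hsc : ∀ x v, fderiv ℝ s x v = k * v i₀ * c x) {ε : ℝ} (hε : 0 ≤ ε)
    (h : ∫ x, (c x * laplacian f x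
        - 2 * k * s x * fderiv ℝ f x (EuclideanSpace.single i₀ 1)) ^ 2
      ≤ ε ^ 2 * ∫ x, (f x * c x) ^ 2) :
    eLpNorm (fun x => laplacian (fun z => f z * c z) x + k ^ 2 * (f x * c x)) 2 volume
      ≤ ENNReal.ofReal ε * eLpNorm (fun x => f x * c x) 2 volume := by
  have hp : ContDiff ℝ (⊤ : ℕ∞) (fun x => f x * c x) := hf.mul hc
  have hpc : HasCompactSupport (fun x => f x * c x) := hfc.mul_right
  refine eLpNorm_two_le_of_integral_sq_le ?_ (hp.continuous.memLp_of_hasCompactSupport hpc) hε ?_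
  · refine Continuous.memLp_of_hasCompactSupport ?_ ?_
    · exact (contDiff_laplacian hp).continuous.add (continuous_const.mul hp.continuous)
    · exact hpc.laplacian.add hpc.mul_left
  · simpa only [laplacian_mul_of_trig i₀ hf hc hs hcs hsc] using h

/-- If a cutoff `f` has small gradient and Laplacian, then modulating it by a plane wave of
frequency `k` gives a real quasi-mode at energy `k ^ 2`. -/
theorem exists_quasimode_of_cutoff {d : ℕ} (i₀ : Fin d) {f : EuclideanSpace ℝ (Fin d) → ℝ}
    (hf : ContDiff ℝ (⊤ : ℕ∞) f) (hfc : HasCompactSupport f) {y : EuclideanSpace ℝ (Fin d)}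
    (hy : f y ≠ 0) (k : ℝ) {ε : ℝ} (hε : 0 ≤ ε)
    (h : ∫ x, (laplacian f x ^ 2
        + 4 * k ^ 2 * fderiv ℝ f x (EuclideanSpace.single i₀ 1) ^ 2) ≤ ε ^ 2 * ∫ x, f x ^ 2) :
    ∃ φ : EuclideanSpace ℝ (Fin d) → ℝ,
      ContDiff ℝ (⊤ : ℕ∞) φ ∧ HasCompactSupport φ ∧ φ ≠ 0 ∧ tsupport φ ⊆ tsupport f ∧
      eLpNorm (fun x => laplacian φ x + k ^ 2 * φ x) 2 volume
        ≤ ENNReal.ofReal ε * eLpNorm φ 2 volume := by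
  let c : EuclideanSpace ℝ (Fin d) → ℝ := fun x => Real.cos (k * (x i₀ - y i₀))
  let s : EuclideanSpace ℝ (Fin d) → ℝ := fun x => Real.sin (k * (x i₀ - y i₀))
  have hphase : ContDiff ℝ (⊤ : ℕ∞)
      (fun x : EuclideanSpace ℝ (Fin d) => k * (x i₀ - y i₀)) := by fun_prop
  have hphase' (x : EuclideanSpace ℝ (Fin d)) :
      HasFDerivAt (fun x : EuclideanSpace ℝ (Fin d) => k * (x i₀ - y i₀))
        (k • EuclideanSpace.proj (𝕜 := ℝ) i₀) x :=
    ((EuclideanSpace.proj (𝕜 := ℝ) i₀).hasFDerivAt.sub_const (y i₀)).const_mul k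
  have hc : ContDiff ℝ (⊤ : ℕ∞) c := hphase.cos
  have hs : ContDiff ℝ (⊤ : ℕ∞) s := hphase.sin
  have hcs (x v) : fderiv ℝ c x v = -(k * v i₀ * s x) := by
    rw [(hphase' x).cos.fderiv]
    simp [s]
    ring
  have hsc (x v) : fderiv ℝ s x v = k * v i₀ * c x := by
    rw [(hphase' x).sin.fderiv]
    simp [c]
    ring
  have hnc_fderiv (x v) : fderiv ℝ (fun z => -c z) x v = k * v i₀ * s x := by
    rw [fderiv_fun_neg, neg_apply, hcs, neg_neg]
  have hcs_sq (x) : c x ^ 2 + s x ^ 2 = 1 := Real.cos_sq_add_sin_sq _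
  have hfcne : (fun x => f x * c x) ≠ 0 := fun h0 => hy (by simpa [c] using congrFun h0 y)
  have hsupp (g : EuclideanSpace ℝ (Fin d) → ℝ) :
      tsupport (fun x => f x * g x) ⊆ tsupport f := tsupport_mul_subset_left
  set P : EuclideanSpace ℝ (Fin d) → ℝ :=
    fun x => fderiv ℝ f x (EuclideanSpace.single i₀ 1)
  have hLc : Continuous (laplacian f) := (contDiff_laplacian hf).continuous
  have hPc : Continuous P := (hf.fderiv_apply_const _).continuous
  have hPs : HasCompactSupport P := hfc.fderiv_apply ℝ _
  have hcc := hc.continuous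
  have hsc' := hs.continuous
  have hfcont := hf.continuous
  have hA : (∫ x, (c x * laplacian f x - 2 * k * s x * P x) ^ 2)
      + ∫ x, (s x * laplacian f x - 2 * k * -c x * P x) ^ 2
      = ∫ x, (laplacian f x ^ 2 + 4 * k ^ 2 * P x ^ 2) := by
    rw [← integral_add]
    · refine integral_congr_ae (.of_forall fun x => ?_)
      linear_combination (laplacian f x ^ 2 + 4 * k ^ 2 * P x ^ 2) * hcs_sq x
    · exact integrable_sq_of_hasCompactSupport (by fun_prop)
        (hfc.laplacian.mul_left.sub hPs.mul_left)
    · exact integrable_sq_of_hasCompactSupport (by fun_prop)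
        (hfc.laplacian.mul_left.sub hPs.mul_left)
  have hB : (∫ x, (f x * c x) ^ 2) + ∫ x, (f x * s x) ^ 2 = ∫ x, f x ^ 2 := by
    rw [← integral_add]
    · refine integral_congr_ae (.of_forall fun x => ?_)
      linear_combination (f x ^ 2) * hcs_sq x
    · exact integrable_sq_of_hasCompactSupport (by fun_prop) hfc.mul_right
    · exact integrable_sq_of_hasCompactSupport (by fun_prop) hfc.mul_right
  rw [← hA, ← hB] at h
  by_cases hcase : (∫ x, (c x * laplacian f x - 2 * k * s x * P x) ^ 2)
      ≤ ε ^ 2 * ∫ x, (f x * c x) ^ 2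
  · exact ⟨_, hf.mul hc, hfc.mul_right, hfcne, hsupp c,
      eLpNorm_laplacian_add_le_of_trig i₀ hf hfc hc hs hcs hsc hε hcase⟩
  · have hcase' : (∫ x, (s x * laplacian f x - 2 * k * -c x * P x) ^ 2)
        < ε ^ 2 * ∫ x, (f x * s x) ^ 2 := by linarith
    refine ⟨_, hf.mul hs, hfc.mul_right, fun h0 => ?_, hsupp s,
      eLpNorm_laplacian_add_le_of_trig i₀ hf hfc hs hc.neg (fun x v => ?_) hnc_fderiv hε
        hcase'.le⟩
    · have hzero (x) : f x * s x = 0 := congrFun h0 x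
      simp only [hzero, ne_eq, OfNat.ofNat_ne_zero, not_false_eq_true, zero_pow, integral_zero,
        mul_zero] at hcase'
      have : 0 ≤ ∫ x, (s x * laplacian f x - 2 * k * -c x * P x) ^ 2 :=
        integral_nonneg fun x => sq_nonneg _
      exact absurd hcase' this.not_gt
    · rw [hsc]
      ring

/-- Dilating a fixed bump makes its gradient and Laplacian as small as desired in `L²`, relative
to the bump itself. -/
theorem exists_scale_integral_le {d : ℕ} (i₀ : Fin d) {f : EuclideanSpace ℝ (Fin d) → ℝ}
    (hf : ContDiff ℝ (⊤ : ℕ∞) f) (hfc : HasCompactSupport f) (hf0 : f ≠ 0) (k : ℝ)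
    {ε : ℝ} (hε : 0 < ε) :
    ∃ r : ℝ, 0 < r ∧ ∀ y : EuclideanSpace ℝ (Fin d),
      ∫ x, (laplacian (fun z => f (r • (z - y))) x ^ 2 + 4 * k ^ 2 *
        fderiv ℝ (fun z => f (r • (z - y))) x (EuclideanSpace.single i₀ 1) ^ 2)
        ≤ ε ^ 2 * ∫ x, f (r • (x - y)) ^ 2 := by
  set P : EuclideanSpace ℝ (Fin d) → ℝ :=
    fun x => fderiv ℝ f x (EuclideanSpace.single i₀ 1)
  have hLc : Continuous (laplacian f) := (contDiff_laplacian hf).continuous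
  have hPc : Continuous P := (hf.fderiv_apply_const _).continuous
  have hPs : HasCompactSupport P := hfc.fderiv_apply ℝ _
  have hL2 := integrable_sq_of_hasCompactSupport hLc hfc.laplacian
  have hP2 := integrable_sq_of_hasCompactSupport hPc hPs
  have hpos : 0 < ∫ x, f x ^ 2 := by
    obtain ⟨x, hx⟩ := Function.ne_iff.1 hf0
    refine Continuous.integral_pos_of_hasCompactSupport_nonneg_nonzero (x := x)
      (hf.continuous.pow 2) ?_ (fun x => sq_nonneg _) (pow_ne_zero 2 hx)
    simp only [sq]
    exact hfc.mul_left
  have hsmall : Filter.Tendsto (fun r : ℝ => r ^ 4 * (∫ x, laplacian f x ^ 2)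
      + 4 * k ^ 2 * (r ^ 2 * ∫ x, P x ^ 2)) (nhdsWithin 0 (Set.Ioi 0)) (nhds 0) := by
    have : Continuous (fun r : ℝ => r ^ 4 * (∫ x, laplacian f x ^ 2)
      + 4 * k ^ 2 * (r ^ 2 * ∫ x, P x ^ 2)) := by fun_prop
    simpa using (this.tendsto 0).mono_left nhdsWithin_le_nhds
  obtain ⟨r, hr, hrpos⟩ := ((hsmall.eventually
    (ge_mem_nhds (mul_pos (pow_pos hε 2) hpos))).and self_mem_nhdsWithin).exists
  refine ⟨r, hrpos, fun y => ?_⟩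
  have hscale (u : EuclideanSpace ℝ (Fin d) → ℝ) :
      ∫ x, u (r • (x - y)) = |(r ^ d)⁻¹| * ∫ x, u x := by
    rw [integral_sub_right_eq_self (fun x => u (r • x)) y, Measure.integral_comp_smul]
    simp
  simp only [laplacian_comp_smul_sub hf, fderiv_comp_smul_sub (hf.differentiable (by simp))]
  rw [hscale (fun z => (r ^ 2 * laplacian f z) ^ 2 + 4 * k ^ 2 * (r * P z) ^ 2),
    hscale (fun z => f z ^ 2), mul_left_comm]
  refine mul_le_mul_of_nonneg_left ?_ (abs_nonneg _)
  simp only [mul_pow, ← pow_mul]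
  rw [integral_add (hL2.const_mul _) ((hP2.const_mul _).const_mul _)]
  simpa only [integral_const_mul] using hr

/-- On a quasi-conical open set, for every `λ ≥ 0` there are smooth compactly supported
quasi-modes for the Dirichlet Laplacian with arbitrarily small relative defect. -/
theorem quasiConical_weyl_sequence {d : ℕ} (hd : 2 ≤ d)
    (Ω : Set (EuclideanSpace ℝ (Fin d))) (hΩopen : IsOpen Ω) (hΩqc : QuasiConical Ω)
    (lam : ℝ) (hlam : 0 ≤ lam) (ε : ℝ) (hε : 0 < ε) :
    ∃ φ : EuclideanSpace ℝ (Fin d) → ℝ,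
      ContDiff ℝ (⊤ : ℕ∞) φ ∧ HasCompactSupport φ ∧ φ ≠ 0 ∧ tsupport φ ⊆ Ω ∧
      eLpNorm (fun x => laplacian φ x + lam * φ x) 2 volume
        ≤ ENNReal.ofReal ε * eLpNorm φ 2 volume := by
  obtain ⟨k, rfl⟩ : ∃ k : ℝ, lam = k ^ 2 := ⟨√lam, (Real.sq_sqrt hlam).symm⟩
  let i₀ : Fin d := ⟨0, by omega⟩
  let η : ContDiffBump (0 : EuclideanSpace ℝ (Fin d)) :=
    ⟨1 / 4, 1 / 2, by norm_num, by norm_num⟩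
  have hη0 : η 0 ≠ 0 := (η.pos_of_mem_ball (Metric.mem_ball_self η.rOut_pos)).ne'
  obtain ⟨r, hr, hη⟩ := exists_scale_integral_le i₀ η.contDiff η.hasCompactSupport
    (fun h => hη0 (congrFun h 0)) k hε
  obtain ⟨y, hy⟩ := hΩqc r⁻¹ (inv_pos.2 hr)
  let f : EuclideanSpace ℝ (Fin d) → ℝ := fun x => η (r • (x - y))
  have hf : ContDiff ℝ (⊤ : ℕ∞) f := η.contDiff.comp (by fun_prop)
  have hsupp : tsupport f ⊆ Metric.closedBall y (r⁻¹ * (1 / 2)) := by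
    refine closure_minimal (fun x hx => ?_) Metric.isClosed_closedBall
    have hx' : r • (x - y) ∈ Metric.ball 0 (1 / 2) := η.support_eq ▸ hx
    rw [mem_ball_zero_iff, norm_smul, Real.norm_of_nonneg hr.le] at hx'
    rw [mem_closedBall_iff_norm, le_inv_mul_iff₀ hr]
    exact hx'.le
  have hfc : HasCompactSupport f :=
    (isCompact_closedBall _ _).of_isClosed_subset (isClosed_tsupport _) hsupp
  obtain ⟨φ, hφ, hφc, hφ0, hφsupp, hφle⟩ :=
    exists_quasimode_of_cutoff i₀ hf hfc (y := y) (by simpa [f] using hη0) k hε.le (hη y)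
  refine ⟨φ, hφ, hφc, hφ0, (hφsupp.trans hsupp).trans (Set.Subset.trans ?_ hy), hφle⟩
  exact Metric.closedBall_subset_ball (mul_lt_of_lt_one_right (inv_pos.2 hr) (by norm_num))
end

section
/- Let d ≥ 1 and λ ≥ 0. There exists a constant C > 0 (depending only on d and λ) such that for every R ≥ 1 and every y ∈ ℝ^d there exists a smooth, compactly supported, not identically zero function φ : ℝ^d → ℝ with supp φ contained in the open ball B(y, R) and ‖Δφ + λφ‖_{L²(ℝ^d)} ≤ (C/R) ‖φ‖_{L²(ℝ^d)}. (Quantitative quasi-mode built from a plane wave modulated by a cut-off in the ball.) -/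
open MeasureTheory

/-- The affine change of variables `x ↦ (x - y) / R` multiplies all `L^2` norms by the same
positive finite factor. -/
lemma exists_eLpNorm_comp_rescale {d : ℕ} (y : EuclideanSpace ℝ (Fin d)) {R : ℝ} (hR : 0 < R) :
    ∃ s : ENNReal, s ≠ 0 ∧ ∀ f : EuclideanSpace ℝ (Fin d) → ℝ, Continuous f →
      eLpNorm (fun x => f (R⁻¹ • (x - y))) 2 volume = s * eLpNorm f 2 volume := by
  have hmap : Measure.map (fun x : EuclideanSpace ℝ (Fin d) => R⁻¹ • (x - y)) volume
      = ENNReal.ofReal |((R⁻¹) ^ Module.finrank ℝ (EuclideanSpace ℝ (Fin d)))⁻¹| • volume := by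
    have h : (fun x : EuclideanSpace ℝ (Fin d) => R⁻¹ • (x - y))
        = (fun x => R⁻¹ • x) ∘ (fun x => x - y) := rfl
    rw [h, ← Measure.map_map (by fun_prop) (by fun_prop), map_sub_right_eq_self,
      Measure.map_addHaar_smul _ (inv_ne_zero hR.ne')]
  have hpos : 0 < |((R⁻¹) ^ Module.finrank ℝ (EuclideanSpace ℝ (Fin d)))⁻¹| := by positivity
  set c := ENNReal.ofReal |((R⁻¹) ^ Module.finrank ℝ (EuclideanSpace ℝ (Fin d)))⁻¹|
  have hc : c ≠ 0 := (ENNReal.ofReal_pos.2 hpos).ne'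
  refine ⟨c ^ (1 / (2 : ENNReal)).toReal, ?_, fun f hf => ?_⟩
  · simp [hc]
  · have h := eLpNorm_map_measure (μ := (volume : Measure (EuclideanSpace ℝ (Fin d)))) (p := 2)
      (g := f) (f := fun x => R⁻¹ • (x - y)) hf.aestronglyMeasurable (by fun_prop)
    rw [hmap, eLpNorm_smul_measure_of_ne_top (by simp)] at h
    simpa [Function.comp_def] using h.symm

lemma fderiv_comp_rescale_apply {E : Type*} [NormedAddCommGroup E] [NormedSpace ℝ E]
    {f : E → ℝ} (hf : Differentiable ℝ f) (R : ℝ) (y x v : E) :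
    fderiv ℝ (fun x => f (R⁻¹ • (x - y))) x v = R⁻¹ * fderiv ℝ f (R⁻¹ • (x - y)) v := by
  have hA : HasFDerivAt (fun x : E => R⁻¹ • (x - y)) (R⁻¹ • ContinuousLinearMap.id ℝ E) x :=
    ((hasFDerivAt_id x).sub_const y).const_smul R⁻¹
  have h := (hf (R⁻¹ • (x - y))).hasFDerivAt.comp x hA
  have h' : fderiv ℝ (fun x => f (R⁻¹ • (x - y))) x = _ := h.fderiv
  simp [h']

lemma fderiv_fderiv_mul_apply {E : Type*} [NormedAddCommGroup E] [NormedSpace ℝ E]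
    {f g : E → ℝ} (hf : ContDiff ℝ 2 f) (hg : ContDiff ℝ 2 g) (x v : E) :
    fderiv ℝ (fun y => fderiv ℝ (fun z => f z * g z) y v) x v
      = fderiv ℝ (fun y => fderiv ℝ f y v) x v * g x
        + 2 * (fderiv ℝ f x v * fderiv ℝ g x v)
        + f x * fderiv ℝ (fun y => fderiv ℝ g y v) x v := by
  have hf1 : Differentiable ℝ f := hf.differentiable (by norm_num)
  have hg1 : Differentiable ℝ g := hg.differentiable (by norm_num)
  have hf2 : Differentiable ℝ (fun y => fderiv ℝ f y v) :=
    ((hf.fderiv_right (m := 1) (by norm_num)).clm_apply contDiff_const).differentiable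
      (by norm_num)
  have hg2 : Differentiable ℝ (fun y => fderiv ℝ g y v) :=
    ((hg.fderiv_right (m := 1) (by norm_num)).clm_apply contDiff_const).differentiable
      (by norm_num)
  have h1 : (fun y => fderiv ℝ (fun z => f z * g z) y v)
      = fun y => f y * fderiv ℝ g y v + g y * fderiv ℝ f y v := by
    funext y
    rw [fderiv_fun_mul (hf1 y) (hg1 y)]
    simp
  rw [h1, fderiv_fun_add ((hf1 x).fun_mul (hg2 x)) ((hg1 x).fun_mul (hf2 x)),
    fderiv_fun_mul (hf1 x) (hg2 x), fderiv_fun_mul (hg1 x) (hf2 x)]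
  simp
  ring

lemma laplacian_mul {d : ℕ} {f g : EuclideanSpace ℝ (Fin d) → ℝ}
    (hf : ContDiff ℝ 2 f) (hg : ContDiff ℝ 2 g) (x : EuclideanSpace ℝ (Fin d)) :
    laplacian (fun z => f z * g z) x = laplacian f x * g x
      + 2 * ∑ i, fderiv ℝ f x (EuclideanSpace.single i 1)
          * fderiv ℝ g x (EuclideanSpace.single i 1)
      + f x * laplacian g x := by
  simp only [laplacian, fderiv_fderiv_mul_apply hf hg, Finset.sum_add_distrib, Finset.sum_mul,
    Finset.mul_sum]

/-- The plane wave `x ↦ sin (k x_j + θ)`. -/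
noncomputable def planeWave {d : ℕ} (j : Fin d) (k θ : ℝ) (x : EuclideanSpace ℝ (Fin d)) : ℝ :=
  Real.sin (k * x j + θ)

lemma contDiff_planeWave {d : ℕ} (j : Fin d) (k θ : ℝ) {n : WithTop ℕ∞} :
    ContDiff ℝ n (planeWave j k θ) := by
  unfold planeWave
  fun_prop

lemma abs_planeWave_le_one {d : ℕ} (j : Fin d) (k θ : ℝ) (x : EuclideanSpace ℝ (Fin d)) :
    |planeWave j k θ x| ≤ 1 :=
  Real.abs_sin_le_one _

lemma fderiv_planeWave_single {d : ℕ} (j : Fin d) (k θ : ℝ) (x : EuclideanSpace ℝ (Fin d))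
    (i : Fin d) :
    fderiv ℝ (planeWave j k θ) x (EuclideanSpace.single i 1)
      = (if j = i then k else 0) * planeWave j k (θ + Real.pi / 2) x := by
  have h1 : HasFDerivAt (fun x : EuclideanSpace ℝ (Fin d) => k * x j + θ)
      (k • (EuclideanSpace.proj j : EuclideanSpace ℝ (Fin d) →L[ℝ] ℝ)) x :=
    ((EuclideanSpace.proj j : EuclideanSpace ℝ (Fin d) →L[ℝ] ℝ).hasFDerivAt.const_mul k).add_const
      θ
  have h2 : fderiv ℝ (planeWave j k θ) x = _ := h1.sin.fderiv
  rw [h2, planeWave, ← add_assoc, Real.sin_add_pi_div_two]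
  by_cases h : j = i <;> simp [h, mul_comm]

lemma laplacian_planeWave {d : ℕ} (j : Fin d) (k θ : ℝ) (x : EuclideanSpace ℝ (Fin d)) :
    laplacian (planeWave j k θ) x = -k ^ 2 * planeWave j k θ x := by
  have h (i : Fin d) : fderiv ℝ (fun y => fderiv ℝ (planeWave j k θ) y
      (EuclideanSpace.single i 1)) x (EuclideanSpace.single i 1)
      = if j = i then -k ^ 2 * planeWave j k θ x else 0 := by
    simp only [fderiv_planeWave_single]
    rw [fderiv_const_mul ((contDiff_planeWave j k _ (n := 1)).differentiable (by norm_num) x)]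
    have hπ : planeWave j k (θ + Real.pi / 2 + Real.pi / 2) x = -planeWave j k θ x := by
      simp only [planeWave, ← Real.sin_add_pi]
      congr 1
      ring
    simp only [smul_apply, smul_eq_mul, fderiv_planeWave_single, hπ]
    split_ifs <;> ring
  simp [laplacian, h]

/-- The two standing waves in quadrature cannot both be small. -/
lemma one_le_abs_planeWave_add {d : ℕ} (j : Fin d) (k : ℝ) (x : EuclideanSpace ℝ (Fin d)) :
    1 ≤ |planeWave j k 0 x| + |planeWave j k (Real.pi / 2) x| := by
  simp only [planeWave, add_zero, Real.sin_add_pi_div_two]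
  have h := Real.sin_sq_add_cos_sq (k * x j)
  rw [← sq_abs (Real.sin _), ← sq_abs (Real.cos _)] at h
  nlinarith [mul_nonneg (abs_nonneg (Real.sin (k * x j))) (abs_nonneg (Real.cos (k * x j))),
    abs_nonneg (Real.sin (k * x j)), abs_nonneg (Real.cos (k * x j))]

/-- Controls the error terms created by multiplying a wave of frequency `k` by a cut-off `χ`. -/
noncomputable def cutoffError {d : ℕ} (k : ℝ) (χ : EuclideanSpace ℝ (Fin d) → ℝ)
    (z : EuclideanSpace ℝ (Fin d)) : ℝ :=
  |laplacian χ z| + 2 * k * ∑ i, |fderiv ℝ χ z (EuclideanSpace.single i 1)|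

lemma continuous_laplacian {d : ℕ} {χ : EuclideanSpace ℝ (Fin d) → ℝ} (hχ : ContDiff ℝ 2 χ) :
    Continuous (laplacian χ) := by
  refine continuous_finsetSum _ fun i _ => ?_
  exact (((hχ.fderiv_right (m := 1) (by norm_num)).clm_apply contDiff_const).continuous_fderiv
    (by norm_num)).clm_apply continuous_const

lemma continuous_cutoffError {d : ℕ} (k : ℝ) {χ : EuclideanSpace ℝ (Fin d) → ℝ}
    (hχ : ContDiff ℝ 2 χ) : Continuous (cutoffError k χ) := by
  have h1 := continuous_laplacian hχ
  have h2 (i : Fin d) : Continuous fun z => fderiv ℝ χ z (EuclideanSpace.single i 1) :=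
    (hχ.continuous_fderiv (by norm_num)).clm_apply continuous_const
  unfold cutoffError
  fun_prop

lemma hasCompactSupport_cutoffError {d : ℕ} (k : ℝ) {χ : EuclideanSpace ℝ (Fin d) → ℝ}
    (hχ : HasCompactSupport χ) : HasCompactSupport (cutoffError k χ) := by
  refine HasCompactSupport.intro hχ fun z hz => ?_
  have h1 (i : Fin d) : fderiv ℝ χ z (EuclideanSpace.single i 1) = 0 :=
    image_eq_zero_of_notMem_tsupport (f := fun y => fderiv ℝ χ y (EuclideanSpace.single i 1))
      fun h => hz (tsupport_fderiv_apply_subset ℝ _ h)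
  have h2 (i : Fin d) : fderiv ℝ (fun y => fderiv ℝ χ y (EuclideanSpace.single i 1)) z
      (EuclideanSpace.single i 1) = 0 :=
    image_eq_zero_of_notMem_tsupport (f := fun x => fderiv ℝ (fun y => fderiv ℝ χ y
      (EuclideanSpace.single i 1)) x (EuclideanSpace.single i 1)) fun h => hz (tsupport_fderiv_apply_subset ℝ _ (tsupport_fderiv_apply_subset ℝ _ h))
  simp [cutoffError, laplacian, h1, h2]

lemma laplacian_comp_rescale {d : ℕ} {χ : EuclideanSpace ℝ (Fin d) → ℝ} (hχ : ContDiff ℝ 2 χ)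
    (R : ℝ) (y x : EuclideanSpace ℝ (Fin d)) :
    laplacian (fun x => χ (R⁻¹ • (x - y))) x = R⁻¹ ^ 2 * laplacian χ (R⁻¹ • (x - y)) := by
  have h1 : Differentiable ℝ χ := hχ.differentiable (by norm_num)
  have h2 (v : EuclideanSpace ℝ (Fin d)) : Differentiable ℝ (fun z => fderiv ℝ χ z v) :=
    ((hχ.fderiv_right (m := 1) (by norm_num)).clm_apply contDiff_const).differentiable
      (by norm_num)
  simp only [laplacian, fderiv_comp_rescale_apply h1, Finset.mul_sum]
  refine Finset.sum_congr rfl fun i _ => ?_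
  rw [fderiv_const_mul]
  · rw [smul_apply, fderiv_comp_rescale_apply (h2 _), smul_eq_mul]
    ring
  · exact (h2 _).comp (by fun_prop : Differentiable ℝ fun x => R⁻¹ • (x - y)) x

lemma abs_laplacian_modulated_le {d : ℕ} {χ : EuclideanSpace ℝ (Fin d) → ℝ}
    (hχ : ContDiff ℝ 2 χ) {R : ℝ} (hR : 1 ≤ R) (y : EuclideanSpace ℝ (Fin d)) (j : Fin d)
    {k : ℝ} (hk : 0 ≤ k) (θ : ℝ) (x : EuclideanSpace ℝ (Fin d)) :
    |laplacian (fun x => χ (R⁻¹ • (x - y)) * planeWave j k θ x) x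
        + k ^ 2 * (χ (R⁻¹ • (x - y)) * planeWave j k θ x)|
      ≤ R⁻¹ * cutoffError k χ (R⁻¹ • (x - y)) := by
  have hR0 : 0 ≤ R⁻¹ := by positivity
  have hR1 : R⁻¹ ≤ 1 := inv_le_one_of_one_le₀ hR
  have hχR : ContDiff ℝ 2 (fun x => χ (R⁻¹ • (x - y))) :=
    hχ.comp (by fun_prop : ContDiff ℝ 2 fun x => R⁻¹ • (x - y))
  rw [laplacian_mul hχR (contDiff_planeWave j k θ), laplacian_planeWave,
    laplacian_comp_rescale hχ]
  simp only [fderiv_comp_rescale_apply (hχ.differentiable (by norm_num)), fderiv_planeWave_single]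
  set z := R⁻¹ • (x - y)
  have hlap : |R⁻¹ ^ 2 * laplacian χ z * planeWave j k θ x| ≤ R⁻¹ * |laplacian χ z| := by
    rw [abs_mul, abs_mul, abs_of_nonneg (by positivity : 0 ≤ R⁻¹ ^ 2)]
    calc R⁻¹ ^ 2 * |laplacian χ z| * |planeWave j k θ x|
        ≤ R⁻¹ ^ 2 * |laplacian χ z| * 1 := by gcongr; exact abs_planeWave_le_one ..
      _ = R⁻¹ * |laplacian χ z| * R⁻¹ := by ring
      _ ≤ R⁻¹ * |laplacian χ z| * 1 := by gcongr
      _ = _ := mul_one _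
  have hcross : |∑ i, R⁻¹ * fderiv ℝ χ z (EuclideanSpace.single i 1)
      * ((if j = i then k else 0) * planeWave j k (θ + Real.pi / 2) x)|
      ≤ R⁻¹ * (k * ∑ i, |fderiv ℝ χ z (EuclideanSpace.single i 1)|) := by
    rw [Finset.mul_sum, Finset.mul_sum]
    refine (Finset.abs_sum_le_sum_abs _ _).trans (Finset.sum_le_sum fun i _ => ?_)
    have hki : |if j = i then k else 0| ≤ k := by
      split_ifs <;> simp [abs_of_nonneg, hk]
    rw [abs_mul, abs_mul, abs_mul, abs_of_nonneg hR0]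
    calc _ ≤ R⁻¹ * |fderiv ℝ χ z (EuclideanSpace.single i 1)| * (k * 1) := by
          gcongr; exact abs_planeWave_le_one ..
      _ = _ := by ring
  rw [cutoffError]
  rw [abs_le] at *
  constructor <;> linarith [hlap.1, hlap.2, hcross.1, hcross.2]

lemma exists_smooth_cutoff (d : ℕ) :
    ∃ χ : EuclideanSpace ℝ (Fin d) → ℝ, ContDiff ℝ (⊤ : ℕ∞) χ ∧ HasCompactSupport χ ∧ χ ≠ 0 ∧
      Function.support χ ⊆ Metric.ball 0 (1 / 2) := by
  let b : ContDiffBump (0 : EuclideanSpace ℝ (Fin d)) :=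
    ⟨1 / 4, 1 / 2, by norm_num, by norm_num⟩
  refine ⟨b, b.contDiff, b.hasCompactSupport, fun h => ?_, b.support_eq.subset⟩
  have h0 : b 0 = 1 := b.one_of_mem_closedBall (by simp [b])
  simp [h] at h0

/-- One of two standing waves in quadrature carries at least half of the norm of the cut-off. -/
lemma exists_phase_eLpNorm_le {d : ℕ} {ψ : EuclideanSpace ℝ (Fin d) → ℝ} (hψ : Continuous ψ)
    (j : Fin d) (k : ℝ) :
    ∃ θ, eLpNorm ψ 2 volume ≤ 2 * eLpNorm (fun x => ψ x * planeWave j k θ x) 2 volume := by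
  have hc (θ : ℝ) : Continuous (fun x => ψ x * planeWave j k θ x) :=
    hψ.mul (contDiff_planeWave j k θ (n := 0)).continuous
  have hsum : eLpNorm ψ 2 volume ≤ eLpNorm (fun x => ψ x * planeWave j k 0 x) 2 volume
      + eLpNorm (fun x => ψ x * planeWave j k (Real.pi / 2) x) 2 volume := by
    have hpt (x : EuclideanSpace ℝ (Fin d)) :
        ‖ψ x‖ ≤ ‖ψ x * planeWave j k 0 x‖ + ‖ψ x * planeWave j k (Real.pi / 2) x‖ := by
      simp only [Real.norm_eq_abs, abs_mul, ← mul_add]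
      exact le_mul_of_one_le_right (abs_nonneg _) (one_le_abs_planeWave_add j k x)
    have hadd := eLpNorm_add_le (μ := (volume : Measure (EuclideanSpace ℝ (Fin d)))) (p := 2)
      (hc 0).norm.aestronglyMeasurable (hc (Real.pi / 2)).norm.aestronglyMeasurable one_le_two
    rw [eLpNorm_norm, eLpNorm_norm] at hadd
    exact (eLpNorm_mono_real hpt).trans hadd
  rcases le_total (eLpNorm (fun x => ψ x * planeWave j k 0 x) 2 volume)
    (eLpNorm (fun x => ψ x * planeWave j k (Real.pi / 2) x) 2 volume) with h | h
  · exact ⟨Real.pi / 2, hsum.trans (by rw [two_mul]; gcongr)⟩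
  · exact ⟨0, hsum.trans (by rw [two_mul]; gcongr)⟩

/-- Quantitative quasi-modes: there is a constant `C = C(d, λ) > 0` such that in any ball of
radius `R ≥ 1` there is a smooth compactly supported nonzero `φ` with
`‖Δφ + λ φ‖_{L²} ≤ (C/R) ‖φ‖_{L²}`. -/
theorem quantitative_quasimode {d : ℕ} (hd : 1 ≤ d) (lam : ℝ) (hlam : 0 ≤ lam) :
    ∃ C : ℝ, 0 < C ∧
      ∀ R : ℝ, 1 ≤ R → ∀ y : EuclideanSpace ℝ (Fin d),
        ∃ φ : EuclideanSpace ℝ (Fin d) → ℝ,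
          ContDiff ℝ (⊤ : ℕ∞) φ ∧ HasCompactSupport φ ∧ φ ≠ 0 ∧
          tsupport φ ⊆ Metric.ball y R ∧
          eLpNorm (fun x => laplacian φ x + lam * φ x) 2 volume
            ≤ ENNReal.ofReal (C / R) * eLpNorm φ 2 volume := by
  obtain ⟨χ, hχ, hχc, hχ0, hχs⟩ := exists_smooth_cutoff d
  have hχ2 : ContDiff ℝ 2 χ := contDiff_infty.1 hχ 2
  set G := cutoffError (√lam) χ
  have hGcont : Continuous G := continuous_cutoffError _ hχ2
  have hGfin : eLpNorm G 2 volume ≠ ⊤ :=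
    (hGcont.memLp_of_hasCompactSupport (hasCompactSupport_cutoffError _ hχc)).eLpNorm_ne_top
  have hχpos : eLpNorm χ 2 volume ≠ 0 := by
    rw [Ne, eLpNorm_eq_zero_iff hχ.continuous.aestronglyMeasurable (by norm_num)]
    intro h
    exact hχ0 ((hχ.continuous.ae_eq_iff_eq volume continuous_zero).1 h)
  have hχfin : eLpNorm χ 2 volume ≠ ⊤ :=
    (hχ.continuous.memLp_of_hasCompactSupport hχc).eLpNorm_ne_top
  set K := (eLpNorm G 2 volume / eLpNorm χ 2 volume).toReal
  have hK : eLpNorm G 2 volume ≤ ENNReal.ofReal (K + 1) * eLpNorm χ 2 volume := by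
    calc eLpNorm G 2 volume
        = eLpNorm G 2 volume / eLpNorm χ 2 volume * eLpNorm χ 2 volume :=
          (ENNReal.div_mul_cancel hχpos hχfin).symm
      _ = ENNReal.ofReal K * eLpNorm χ 2 volume := by
          rw [ENNReal.ofReal_toReal (ENNReal.div_ne_top hGfin hχpos)]
      _ ≤ _ := by gcongr; linarith
  have hK0 : 0 ≤ K := ENNReal.toReal_nonneg
  refine ⟨(K + 1) * 2, by positivity, fun R hR y => ?_⟩
  have hR0 : 0 < R := by linarith
  obtain ⟨s, hs0, hs⟩ := exists_eLpNorm_comp_rescale y hR0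
  have hψ : ContDiff ℝ (⊤ : ℕ∞) (fun x => χ (R⁻¹ • (x - y))) :=
    hχ.comp (by fun_prop : ContDiff ℝ (⊤ : ℕ∞) fun x => R⁻¹ • (x - y))
  obtain ⟨θ, hθ⟩ := exists_phase_eLpNorm_le hψ.continuous ⟨0, hd⟩ √lam
  have hsupp : Function.support (fun x => χ (R⁻¹ • (x - y)) * planeWave ⟨0, hd⟩ √lam θ x)
      ⊆ Metric.closedBall y (R / 2) := by
    intro x hx
    have hz := hχs (show R⁻¹ • (x - y) ∈ Function.support χ from left_ne_zero_of_mul hx)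
    rw [mem_ball_zero_iff, norm_smul, Real.norm_of_nonneg (by positivity),
      inv_mul_lt_iff₀ hR0] at hz
    rw [mem_closedBall_iff_norm]
    linarith
  refine ⟨fun x => χ (R⁻¹ • (x - y)) * planeWave ⟨0, hd⟩ √lam θ x,
    hψ.mul (contDiff_planeWave _ _ _),
    HasCompactSupport.of_support_subset_isCompact (isCompact_closedBall _ _) hsupp,
    fun h => ?_,
    (closure_minimal hsupp Metric.isClosed_closedBall).trans
      (Metric.closedBall_subset_ball (by linarith)), ?_⟩
  · rw [h, hs χ hχ.continuous, eLpNorm_zero, mul_zero] at hθ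
    exact mul_ne_zero hs0 hχpos (le_antisymm hθ zero_le)
  calc _ ≤ eLpNorm (fun x => R⁻¹ * G (R⁻¹ • (x - y))) 2 volume := by
        refine eLpNorm_mono fun x => ?_
        have h := abs_laplacian_modulated_le hχ2 hR y ⟨0, hd⟩ (Real.sqrt_nonneg lam) θ x
        rw [Real.sq_sqrt hlam] at h
        exact h.trans (le_abs_self _)
    _ = ENNReal.ofReal R⁻¹ * (s * eLpNorm G 2 volume) := by
        rw [← hs G hGcont]
        have h := eLpNorm_const_smul R⁻¹ (fun x => G (R⁻¹ • (x - y))) 2 volume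
        rw [Real.enorm_of_nonneg (by positivity)] at h
        exact h
    _ ≤ ENNReal.ofReal R⁻¹ * (s * (ENNReal.ofReal (K + 1) * eLpNorm χ 2 volume)) := by gcongr
    _ = ENNReal.ofReal R⁻¹ * ENNReal.ofReal (K + 1) * (s * eLpNorm χ 2 volume) := by ring
    _ = ENNReal.ofReal R⁻¹ * ENNReal.ofReal (K + 1)
          * eLpNorm (fun x => χ (R⁻¹ • (x - y))) 2 volume := by rw [hs χ hχ.continuous]
    _ ≤ ENNReal.ofReal R⁻¹ * ENNReal.ofReal (K + 1) * (2 * eLpNorm _ 2 volume) := by gcongr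
    _ = _ := by
        have h2 : ENNReal.ofReal ((K + 1) * 2 / R)
            = ENNReal.ofReal R⁻¹ * ENNReal.ofReal (K + 1) * 2 := by
          rw [← ENNReal.ofReal_ofNat 2, ← ENNReal.ofReal_mul (by positivity),
            ← ENNReal.ofReal_mul (by positivity)]
          congr 1
          ring
        rw [h2, mul_assoc _ 2]
end

section
/- Fix d ≥ 2. Let (a_n)_{n≥1} be positive reals with a_n → ∞, and define x_1 = a_1 and x_{n+1} = x_n + a_n + a_{n+1}. Let e_1 be the first standard basis vector and set ω_n = Q_{a_n}(x_n e_1), Ω = ⋃_{n≥1} ω_n. Then the open cubes ω_n are pairwise disjoint, Ω is open, and Ω is quasi-conical, i.e. for every r > 0 there exists y ∈ ℝ^d with the open ball B(y, r) ⊆ Ω. -/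
/-- The open cube of half-width `a` centred at `c`:
`Q_a(c) = {x : |xᵢ - cᵢ| < a for all i}`. -/
def openCube {d : ℕ} (a : ℝ) (c : EuclideanSpace ℝ (Fin d)) :
    Set (EuclideanSpace ℝ (Fin d)) :=
  {x | ∀ i : Fin d, |x i - c i| < a}

theorem isOpen_openCube {d : ℕ} (a : ℝ) (c : EuclideanSpace ℝ (Fin d)) :
    IsOpen (openCube a c) := by
  simp only [openCube, Set.ofPred_forall]
  exact isOpen_iInter_of_finite fun i => isOpen_lt (by fun_prop) continuous_const

theorem ball_subset_openCube {d : ℕ} {r a : ℝ} (hra : r ≤ a)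
    (c : EuclideanSpace ℝ (Fin d)) : Metric.ball c r ⊆ openCube a c := by
  intro y hy i
  rw [Metric.mem_ball, dist_eq_norm] at hy
  have h := PiLp.norm_apply_le (y - c) i
  rw [PiLp.sub_apply, Real.norm_eq_abs] at h
  linarith

/-- Cubes whose projections to some coordinate axis are separated are disjoint. -/
theorem disjoint_openCube {d : ℕ} {a b : ℝ} {c e : EuclideanSpace ℝ (Fin d)} (i : Fin d)
    (h : c i + a ≤ e i - b) : Disjoint (openCube a c) (openCube b e) := by
  rw [Set.disjoint_left]
  intro y hy hy'
  have h1 := (abs_lt.1 (hy i)).2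
  have h2 := (abs_lt.1 (hy' i)).1
  linarith

theorem add_le_sub_of_tower {a x : ℕ → ℝ} (ha : ∀ n, 1 ≤ n → 0 < a n)
    (hx : ∀ n, 1 ≤ n → x (n + 1) = x n + a n + a (n + 1)) {m n : ℕ} (hm : 1 ≤ m)
    (hmn : m < n) : x m + a m ≤ x n - a n := by
  induction n, hmn using Nat.le_induction with
  | base => linarith [hx m hm]
  | succ k hk ih =>
    have hk1 : 1 ≤ k := by omega
    linarith [hx k hk1, ha k hk1]

/-- The tower of disjoint cubes of growing size is an open quasi-conical set and the cubes
are pairwise disjoint. -/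
theorem tower_of_cubes_quasiConical {d : ℕ} (hd : 2 ≤ d)
    (a : ℕ → ℝ) (ha : ∀ n, 1 ≤ n → 0 < a n)
    (ha' : Filter.Tendsto a Filter.atTop Filter.atTop)
    (x : ℕ → ℝ) (hx1 : x 1 = a 1)
    (hx : ∀ n, 1 ≤ n → x (n + 1) = x n + a n + a (n + 1))
    (ω : ℕ → Set (EuclideanSpace ℝ (Fin d)))
    (hω : ∀ n, ω n = openCube (a n) (EuclideanSpace.single (⟨0, by omega⟩ : Fin d) (x n)))
    (Ω : Set (EuclideanSpace ℝ (Fin d))) (hΩ : Ω = ⋃ n ∈ {n : ℕ | 1 ≤ n}, ω n) :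
    (∀ m n, 1 ≤ m → 1 ≤ n → m ≠ n → Disjoint (ω m) (ω n)) ∧
    IsOpen Ω ∧ QuasiConical Ω := by
  have hdisj : ∀ m n, 1 ≤ m → m < n → Disjoint (ω m) (ω n) := by
    intro m n hm hmn
    rw [hω, hω]
    refine disjoint_openCube ⟨0, by omega⟩ ?_
    simpa using add_le_sub_of_tower ha hx hm hmn
  refine ⟨fun m n hm hn hne => ?_, ?_, fun r _ => ?_⟩
  · rcases hne.lt_or_gt with h | h
    · exact hdisj m n hm h
    · exact (hdisj n m hn h).symm
  · rw [hΩ]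
    refine isOpen_biUnion fun n _ => ?_
    rw [hω]
    exact isOpen_openCube _ _
  · obtain ⟨n, hrn, hn⟩ :=
      ((ha'.eventually_ge_atTop r).and (Filter.eventually_ge_atTop 1)).exists
    refine ⟨EuclideanSpace.single ⟨0, by omega⟩ (x n), (ball_subset_openCube hrn _).trans ?_⟩
    rw [← hω, hΩ]
    exact Set.subset_biUnion_of_mem (u := ω) (show n ∈ {n : ℕ | 1 ≤ n} from hn)
end
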